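/- Suppose X is a set of s = tr distinct points in ℙ^1 × ℙ^1 such that α_X = (r,…,r) (t times) and β_X = (t,…,t) (r times). Then, writing π_1(X) = {P_1,…,P_t} and π_2(X) = {Q_1,…,Q_r}, X equals the full grid {P_i × Q_j : 1 ≤ i ≤ t, 1 ≤ j ≤ r}, its ideal is I_X = (L_{P_1}L_{P_2}⋯L_{P_t}, L_{Q_1}L_{Q_2}⋯L_{Q_r}) where L_{P_i} is the degree-(1,0) form vanishing on π_1^{-1}(P_i) and L_{Q_j} is the degree-(0,1) form vanishing on π_2^{-1}(Q_j), these two generators form a regular sequence on R, and hence X is a complete intersection whose minimal free resolution is 0 → R(−t,−r) → R(−t,0) ⊕ R(0,−r) → I_X → 0. -/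

import Mathlib

open MvPolynomial

noncomputable section

namespace PaperMP

variable (K : Type) [Field K] [IsAlgClosed K] [CharZero K]
variable (k : ℕ) (n : Fin k → ℕ)

/-- Index type of the variables `x_{i,j}`, `1 ≤ i ≤ k`, `0 ≤ j ≤ n i`. -/
abbrev Sig := Σ i : Fin k, Fin (n i + 1)

/-- The `ℕ^k`-graded polynomial ring `R`. -/
abbrev MPRing := MvPolynomial (Sig k n) K

/-- The grading of `R`: `deg x_{i,j} = e_i`. -/
def wt : Sig k n → (Fin k → ℕ) := fun p => Pi.single p.1 1

/-- A point of `ℙ^{n_1} × ⋯ × ℙ^{n_k}`. -/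
abbrev MPPoint := ∀ i : Fin k, Projectivization K (Fin (n i + 1) → K)

/-- The affine cone over a point of multiprojective space. -/
def cone (P : MPPoint K k n) : Set (Sig k n → K) :=
  {x | ∀ i : Fin k, ∃ c : K, (fun j => x ⟨i, j⟩) = c • (P i).rep}

/-- Vanishing ideal of a set of points of affine space. -/
def vanishingIdeal (T : Set (Sig k n → K)) : Ideal (MPRing K k n) :=
  ⨅ x ∈ T, RingHom.ker (MvPolynomial.eval x)

/-- The (prime) ideal `I_P` of a point of multiprojective space. -/
def idealOfPoint (P : MPPoint K k n) : Ideal (MPRing K k n) :=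
  vanishingIdeal K k n (cone K k n P)

/-- The ideal `I_X` of a set of points of multiprojective space. -/
def idealOfSet (X : Set (MPPoint K k n)) : Ideal (MPRing K k n) :=
  ⨅ P ∈ X, idealOfPoint K k n P

/-- The Hilbert function of `R/I` in multidegree `d`. -/
def hilb (I : Ideal (MPRing K k n)) (d : Fin k → ℕ) : ℕ :=
  Module.finrank K ((weightedHomogeneousSubmodule K (wt k n) d).map
    (Ideal.Quotient.mkₐ K I).toLinearMap)

/-- The irrelevant maximal ideal `m = (x_{1,0},…,x_{k,n_k})`. -/
def maxIdeal : Ideal (MPRing K k n) :=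
  Ideal.span (Set.range (MvPolynomial.X : Sig k n → MPRing K k n))

/-- `L` is a regular sequence modulo `I`:  `(I,L) ⊆ m`, and each entry is a
non-zero divisor modulo `I` together with the previous entries. -/
def IsRegSeqMod (I : Ideal (MPRing K k n)) (L : List (MPRing K k n)) : Prop :=
  I ⊔ Ideal.span {f | f ∈ L} ≤ maxIdeal K k n ∧
  ∀ i : Fin L.length, ∀ G : MPRing K k n,
    L.get i * G ∈ I ⊔ Ideal.span {f | f ∈ L.take i} →
      G ∈ I ⊔ Ideal.span {f | f ∈ L.take i}

/-- `depth R/I = l`: `l` is the length of a maximal regular sequence modulo `I`. -/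
def hasDepth (I : Ideal (MPRing K k n)) (l : ℕ) : Prop :=
  IsGreatest {r : ℕ | ∃ L : List (MPRing K k n), L.length = r ∧ IsRegSeqMod K k n I L} l

/-- `X` is arithmetically Cohen–Macaulay: `depth R/I_X = K-dim R/I_X = k`. -/
def IsACM (X : Set (MPPoint K k n)) : Prop :=
  hasDepth K k n (idealOfSet K k n X) k

/-! ### The first difference function -/

/-- Extend `H : ℕ^k → ℕ` by zero outside ℕ^k. -/
def extNeg (H : (Fin k → ℕ) → ℕ) (j : Fin k → ℤ) : ℤ :=
  if ∀ i, 0 ≤ j i then H (fun i => (j i).toNat) else 0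

/-- The first difference function `ΔH` of a numerical function `H : ℕ^k → ℕ`. -/
def delta (H : (Fin k → ℕ) → ℕ) (d : Fin k → ℕ) : ℤ :=
  ∑ l : Fin k → Fin 2, (-1 : ℤ) ^ (∑ i, (l i : ℕ)) *
    extNeg k H (fun i => (d i : ℤ) - (l i : ℕ))

/-! ### The ring `S = k[x_{1,1},…,x_{k,n_k}]` -/

/-- Index type of the variables `x_{i,j}`, `1 ≤ i ≤ k`, `1 ≤ j ≤ n i`. -/
abbrev SigS := Σ i : Fin k, Fin (n i)

/-- The `ℕ^k`-graded polynomial ring `S`. -/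
abbrev SRing := MvPolynomial (SigS k n) K

/-- The grading of `S`: `deg x_{i,j} = e_i`. -/
def wtS : SigS k n → (Fin k → ℕ) := fun p => Pi.single p.1 1

/-- The Hilbert function of `S/J` in multidegree `d`. -/
def hilbS (J : Ideal (SRing K k n)) (d : Fin k → ℕ) : ℕ :=
  Module.finrank K ((weightedHomogeneousSubmodule K (wtS k n) d).map
    (Ideal.Quotient.mkₐ K J).toLinearMap)

/-- `J` is an `ℕ^k`-homogeneous ideal of `S`. -/
def IsHomogIdealS (J : Ideal (SRing K k n)) : Prop :=
  ∀ f ∈ J, ∀ d : Fin k → ℕ, weightedHomogeneousComponent (wtS k n) d f ∈ J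

/-- `J` is an artinian ideal of `S`: `√J = (x_{1,1},…,x_{k,n_k})`. -/
def IsArtinianIdealS (J : Ideal (SRing K k n)) : Prop :=
  J.radical = Ideal.span (Set.range (MvPolynomial.X : SigS k n → SRing K k n))

/-! ### The ring `k[x_1,…,x_k]`, with `deg x_i = e_i` -/

abbrev TRing := MvPolynomial (Fin k) K

/-- The grading: `deg x_i = e_i`. -/
def wtT : Fin k → (Fin k → ℕ) := fun i => Pi.single i 1

/-- The Hilbert function of `k[x_1,…,x_k]/I` in multidegree `d`. -/
def hilbT (I : Ideal (TRing K k)) (d : Fin k → ℕ) : ℕ :=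
  Module.finrank K ((weightedHomogeneousSubmodule K (wtT k) d).map
    (Ideal.Quotient.mkₐ K I).toLinearMap)

/-- `I` is an `ℕ^k`-homogeneous ideal of `k[x_1,…,x_k]`. -/
def IsHomogIdealT (I : Ideal (TRing K k)) : Prop :=
  ∀ f ∈ I, ∀ d : Fin k → ℕ, weightedHomogeneousComponent (wtT k) d f ∈ I

/-- `I` is an artinian ideal of `k[x_1,…,x_k]`: `√I = (x_1,…,x_k)`. -/
def IsArtinianIdealT (I : Ideal (TRing K k)) : Prop :=
  I.radical = Ideal.span (Set.range (MvPolynomial.X : Fin k → TRing K k))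

/-! ### Lifting monomial ideals -/

/-- The lift `m̄ = ∏_{i,j} ∏_{l=1}^{a_{i,j}} (x_{i,j} - (l-1) x_{i,0})` of the monomial
of `S` with exponent vector `b`, via the lifting matrix `𝒜`. -/
def liftMonomial (b : SigS k n →₀ ℕ) : MPRing K k n :=
  ∏ p ∈ b.support, ∏ l ∈ Finset.range (b p),
    (MvPolynomial.X (⟨p.1, p.2.succ⟩ : Sig k n) - (l : MPRing K k n) * MvPolynomial.X ⟨p.1, 0⟩)

/-- `J` is a monomial ideal of `S`. -/
def IsMonomialIdeal (J : Ideal (SRing K k n)) : Prop :=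
  ∃ A : Set (SigS k n →₀ ℕ), J = Ideal.span ((fun b => (monomial b (1 : K) : SRing K k n)) '' A)

/-- The exponent vectors of the minimal monomial generators of a monomial ideal `J ⊆ S`. -/
def minGens (J : Ideal (SRing K k n)) : Set (SigS k n →₀ ℕ) :=
  {b | (monomial b (1 : K) : SRing K k n) ∈ J ∧
    ∀ b' : SigS k n →₀ ℕ, b' ≤ b → b' ≠ b → (monomial b' (1 : K) : SRing K k n) ∉ J}

/-- The lift to `R` of a monomial ideal `J ⊆ S`, generated by the lifts of the
minimal monomial generators of `J`. -/
def liftIdeal (J : Ideal (SRing K k n)) : Ideal (MPRing K k n) :=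
  Ideal.span (liftMonomial K k n '' minGens K k n J)

/-- The projection `R → S ≅ R/(x_{1,0},…,x_{k,0})` sending `x_{i,0} ↦ 0` and
`x_{i,j} ↦ x_{i,j}` for `j ≥ 1`. -/
def projToS : MPRing K k n →ₐ[K] SRing K k n :=
  aeval (fun p : Sig k n =>
    if h : p.2 = 0 then 0 else MvPolynomial.X (⟨p.1, p.2.pred h⟩ : SigS k n))

/-- The point `[1:b_{i,1}:⋯:b_{i,n_i}] × ⋯` of multiprojective space associated to the
exponent vector `b` of a monomial of `S`. -/
def monToPoint (b : SigS k n →₀ ℕ) : MPPoint K k n := fun i =>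
  Projectivization.mk K
    (fun j : Fin (n i + 1) => if h : j = 0 then 1 else ((b ⟨i, j.pred h⟩ : ℕ) : K))
    (fun hc => by simpa using congrFun hc 0)

/-! ### Partitions -/

/-- `lam` is a partition: positive non-increasing entries. -/
def IsPartition {t : ℕ} (lam : Fin t → ℕ) : Prop :=
  (∀ j, 0 < lam j) ∧ Antitone lam

/-- `lam` is a partition of `s`. -/
def IsPartitionOf (s : ℕ) {t : ℕ} (lam : Fin t → ℕ) : Prop :=
  IsPartition lam ∧ ∑ j, lam j = s

/-- The `(i+1)`-st entry `λ*_{i+1} = #{j : λ_j ≥ i+1}` of the conjugate partition. -/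
def conjEntry {t : ℕ} (lam : Fin t → ℕ) (i : ℕ) : ℕ :=
  (Finset.univ.filter fun j : Fin t => i + 1 ≤ lam j).card

/-- `β` is the conjugate partition `α*` of `α`. -/
def IsConjugateOf {t m : ℕ} (α : Fin t → ℕ) (β : Fin m → ℕ) : Prop :=
  (∀ i : Fin m, β i = conjEntry α i) ∧ ∀ i : ℕ, m ≤ i → conjEntry α i = 0

/-! ### `ℙ^1 × ℙ^1` -/

/-- A point of `ℙ^1`. -/
abbrev Proj1 := Projectivization K (Fin 2 → K)

/-- A point of `ℙ^1 × ℙ^1`. -/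
abbrev Pt2 := MPPoint K 2 (fun _ => 1)

/-- The coordinate ring of `ℙ^1 × ℙ^1`. -/
abbrev R2 := MPRing K 2 (fun _ => 1)

/-- `P` enumerates the distinct first coordinates of `X` and `α` lists the sizes of the
corresponding fibers, in non-increasing order; so `α = α_X`. -/
def IsAlphaLabel (X : Set (Pt2 K)) {t : ℕ} (P : Fin t → Proj1 K) (α : Fin t → ℕ) : Prop :=
  Function.Injective P ∧ (Set.range P = (fun Z : Pt2 K => Z 0) '' X) ∧
  (∀ i, α i = Set.ncard {Z | Z ∈ X ∧ Z 0 = P i}) ∧ Antitone α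

/-- `Q` enumerates the distinct second coordinates of `X` and `β` lists the sizes of the
corresponding fibers, in non-increasing order; so `β = β_X`. -/
def IsBetaLabel (X : Set (Pt2 K)) {r : ℕ} (Q : Fin r → Proj1 K) (β : Fin r → ℕ) : Prop :=
  Function.Injective Q ∧ (Set.range Q = (fun Z : Pt2 K => Z 1) '' X) ∧
  (∀ i, β i = Set.ncard {Z | Z ∈ X ∧ Z 1 = Q i}) ∧ Antitone β

/-- `α = α_X`. -/
def IsAlphaPartition (X : Set (Pt2 K)) {t : ℕ} (α : Fin t → ℕ) : Prop :=
  ∃ P : Fin t → Proj1 K, IsAlphaLabel K X P α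

/-- `β = β_X`. -/
def IsBetaPartition (X : Set (Pt2 K)) {r : ℕ} (β : Fin r → ℕ) : Prop :=
  ∃ Q : Fin r → Proj1 K, IsBetaLabel K X Q β

/-- `F` is "the" form of degree `(1,0)` vanishing at all points of `ℙ^1 × ℙ^1` whose
first coordinate is `P`. -/
def IsForm1Of (P : Proj1 K) (F : R2 K) : Prop :=
  IsWeightedHomogeneous (wt 2 (fun _ => 1)) F (Pi.single 0 1) ∧ F ≠ 0 ∧
  ∀ x : Sig 2 (fun _ => 1) → K,
    (∃ c : K, (fun j : Fin 2 => x ⟨0, j⟩) = c • P.rep) → MvPolynomial.eval x F = 0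

/-- `F` is "the" form of degree `(0,1)` vanishing at all points of `ℙ^1 × ℙ^1` whose
second coordinate is `P`. -/
def IsForm2Of (P : Proj1 K) (F : R2 K) : Prop :=
  IsWeightedHomogeneous (wt 2 (fun _ => 1)) F (Pi.single 1 1) ∧ F ≠ 0 ∧
  ∀ x : Sig 2 (fun _ => 1) → K,
    (∃ c : K, (fun j : Fin 2 => x ⟨1, j⟩) = c • P.rep) → MvPolynomial.eval x F = 0

end PaperMP

namespace PaperMP

section SpanPair

variable {A : Type*} [CommRing A] {ι κ : Type*}

/-- If each `q j` is a non-zero-divisor modulo `(a, q j')` for `j' ≠ j`, then the intersection of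
the ideals `(a, q j)` lies in `(a, ∏ j, q j)`. -/
theorem mem_span_pair_prod {a : A} {q : κ → A} (s : Finset κ)
    (hq : ∀ j ∈ s, ∀ j' ∈ s, j ≠ j' → ∀ g, q j * g ∈ Ideal.span {a, q j'} →
      g ∈ Ideal.span {a, q j'}) {f : A} (hf : ∀ j ∈ s, f ∈ Ideal.span {a, q j}) :
    f ∈ Ideal.span {a, ∏ j ∈ s, q j} := by
  classical
  induction s using Finset.induction_on generalizing f with
  | empty => simp [Ideal.span_insert]
  | insert j s hj ih =>
    obtain ⟨u, v, huv⟩ := Ideal.mem_span_pair.1 (hf j (Finset.mem_insert_self j s))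
    have hv : v ∈ Ideal.span {a, ∏ j ∈ s, q j} := by
      refine ih (fun i hi i' hi' => hq i (Finset.mem_insert_of_mem hi) i'
        (Finset.mem_insert_of_mem hi')) fun j' hj' => ?_
      refine hq j (Finset.mem_insert_self j s) j' (Finset.mem_insert_of_mem hj')
        (fun h => hj (h ▸ hj')) v ?_
      have h1 : q j * v = f - u * a := by rw [← huv]; ring
      rw [h1]
      exact Ideal.sub_mem _ (hf j' (Finset.mem_insert_of_mem hj'))
        (Ideal.mul_mem_left _ _ (Ideal.subset_span (by simp)))
    obtain ⟨u', w, hw⟩ := Ideal.mem_span_pair.1 hv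
    rw [Finset.prod_insert hj]
    refine Ideal.mem_span_pair.2 ⟨u + q j * u', w, ?_⟩
    rw [← huv, ← hw]
    ring

theorem span_pair_prod_le {a : A} {q : κ → A} {s : Finset κ} {j : κ} (hj : j ∈ s) :
    Ideal.span {a, ∏ j ∈ s, q j} ≤ Ideal.span {a, q j} := by
  rw [Ideal.span_le, Set.insert_subset_iff, Set.singleton_subset_iff]
  exact ⟨Ideal.subset_span (by simp),
    Ideal.mem_of_dvd _ (Finset.dvd_prod_of_mem q hj) (Ideal.subset_span (by simp))⟩

/-- A grid of pairwise incomparable primes `(p i, q j)` intersects in the complete intersection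
`(∏ i, p i, ∏ j, q j)`. -/
theorem iInf_span_pair_eq_span_prod [Fintype ι] [Fintype κ] {p : ι → A} {q : κ → A}
    (hprime : ∀ i j, (Ideal.span {p i, q j}).IsPrime)
    (hp : ∀ i i' j, i ≠ i' → p i ∉ Ideal.span {p i', q j})
    (hq : ∀ i j j', j ≠ j' → q j ∉ Ideal.span {p i, q j'}) :
    ⨅ (i) (j), Ideal.span {p i, q j} = Ideal.span {∏ i, p i, ∏ j, q j} := by
  have hrow (i : ι) (f : A) :
      f ∈ Ideal.span {∏ j, q j, p i} ↔ ∀ j, f ∈ Ideal.span {p i, q j} := by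
    rw [Set.pair_comm]
    refine ⟨fun h j => span_pair_prod_le (Finset.mem_univ j) h, fun h => ?_⟩
    refine mem_span_pair_prod _ (fun j _ j' _ hjj g hg => ?_) fun j _ => h j
    exact ((hprime i j').mem_or_mem hg).resolve_left (hq i j j' hjj)
  ext f
  simp only [Ideal.mem_iInf, ← hrow]
  rw [Set.pair_comm (∏ i, p i)]
  refine ⟨fun h => mem_span_pair_prod _ (fun i _ i' _ hii g hg => ?_) fun i _ => h i,
    fun h i => span_pair_prod_le (Finset.mem_univ i) h⟩
  rw [hrow] at hg ⊢
  exact fun j => ((hprime i' j).mem_or_mem (hg j)).resolve_left (hp i i' j hii)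

end SpanPair

section Multiprojective

variable {K : Type} [Field K] {k : ℕ} {n : Fin k → ℕ}

/-- Pullback of polynomials along the parametrization of the affine cone over `Z` by `K^k`. -/
def conePullback (Z : MPPoint K k n) : MPRing K k n →ₐ[K] MvPolynomial (Fin k) K :=
  aeval fun s => C ((Z s.1).rep s.2) * MvPolynomial.X s.1

theorem eval_conePullback (Z : MPPoint K k n) (c : Fin k → K) (f : MPRing K k n) :
    eval c (conePullback Z f) = eval (fun s => c s.1 * (Z s.1).rep s.2) f := by
  induction f using MvPolynomial.induction_on with
  | C a => simp [conePullback, algebraMap_eq]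
  | add p q hp hq => simp [hp, hq]
  | mul_X p s hp => rw [map_mul, map_mul, map_mul, hp]; simp [conePullback, mul_comm]

theorem mem_idealOfPoint {Z : MPPoint K k n} {f : MPRing K k n} :
    f ∈ idealOfPoint K k n Z ↔
      ∀ c : Fin k → K, eval (fun s : Sig k n => c s.1 * (Z s.1).rep s.2) f = 0 := by
  simp only [idealOfPoint, vanishingIdeal, Ideal.mem_iInf, RingHom.mem_ker]
  refine ⟨fun h c => h _ fun i => ⟨c i, rfl⟩, fun h x hx => ?_⟩
  choose c hc using hx
  rw [← h c]
  congr 2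
  ext ⟨i, j⟩
  exact congrFun (hc i) j

theorem idealOfPoint_eq_ker [Infinite K] (Z : MPPoint K k n) :
    idealOfPoint K k n Z = RingHom.ker (conePullback Z) := by
  ext f
  rw [mem_idealOfPoint, RingHom.mem_ker, MvPolynomial.funext_iff]
  simp [eval_conePullback]

theorem idealOfPoint_isPrime [Infinite K] (Z : MPPoint K k n) :
    (idealOfPoint K k n Z).IsPrime := by
  rw [idealOfPoint_eq_ker]
  exact RingHom.ker_isPrime _

theorem exists_eq_single_of_weight_eq_single {d : Sig k n →₀ ℕ} {i : Fin k}
    (h : Finsupp.weight (wt k n) d = Pi.single i 1) :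
    ∃ j, d = Finsupp.single ⟨i, j⟩ 1 := by
  have key (e : Sig k n →₀ ℕ) (s : Sig k n) (hs : e s ≠ 0) :
      1 ≤ Finsupp.weight (wt k n) e s.1 := by
    simpa [wt] using Finsupp.le_weight_of_ne_zero' (wt k n) hs s.1
  obtain ⟨s, hs⟩ : ∃ s, d s ≠ 0 := by
    by_contra! h0
    obtain rfl : d = 0 := Finsupp.ext h0
    simpa using congrFun h i
  have hsi : s.1 = i := by
    by_contra hne
    simpa [h, hne] using key d s hs
  obtain ⟨i', j⟩ := s
  obtain rfl : i' = i := hsi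
  have h1 := Finsupp.weight_sub_single_add (w := wt k n) hs
  have h2 : Finsupp.weight (wt k n) (d - Finsupp.single ⟨i', j⟩ 1) = 0 := by
    rw [h] at h1
    exact add_eq_right.1 h1
  have h3 : d - Finsupp.single ⟨i', j⟩ 1 = 0 := by
    ext s
    by_contra hne
    simpa [h2] using key _ s hne
  refine ⟨j, ?_⟩
  rw [← Finsupp.sub_add_single_one_cancel hs, h3, zero_add]

theorem eq_sum_of_isWeightedHomogeneous_single {f : MPRing K k n} {i : Fin k}
    (h : IsWeightedHomogeneous (wt k n) f (Pi.single i 1)) :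
    f = ∑ j, C (coeff (Finsupp.single ⟨i, j⟩ 1) f) * MvPolynomial.X ⟨i, j⟩ := by
  classical
  ext d
  simp only [coeff_sum, coeff_C_mul, coeff_X]
  by_cases hd : ∃ j, d = Finsupp.single ⟨i, j⟩ 1
  · obtain ⟨j, rfl⟩ := hd
    rw [Finset.sum_eq_single j] <;> simp +contextual [Finsupp.single_left_inj]
  · rw [Finset.sum_eq_zero]
    · by_contra hne
      exact hd (exists_eq_single_of_weight_eq_single (h hne))
    · intro j _
      rw [if_neg fun h => hd ⟨j, h.symm⟩, mul_zero]

end Multiprojective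

section ProjectiveLines

variable {K : Type} [Field K]

/-- The linear form in the `i`-th set of variables that vanishes at `p`. -/
def pointForm (i : Fin 2) (p : Proj1 K) : R2 K :=
  C (p.rep 1) * MvPolynomial.X ⟨i, 0⟩ - C (p.rep 0) * MvPolynomial.X ⟨i, 1⟩

theorem eval_pointForm (i : Fin 2) (p : Proj1 K) (x : Sig 2 (fun _ => 1) → K) :
    eval x (pointForm i p) = p.rep 1 * x ⟨i, 0⟩ - p.rep 0 * x ⟨i, 1⟩ := by
  simp [pointForm]

theorem rep_zero_ne_zero_or (p : Proj1 K) : p.rep 0 ≠ 0 ∨ p.rep 1 ≠ 0 := by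
  by_contra! h
  refine p.rep_nonzero ?_
  ext j
  fin_cases j
  exacts [h.1, h.2]

theorem eq_of_rep_mul_eq {p q : Proj1 K} (h : p.rep 1 * q.rep 0 = p.rep 0 * q.rep 1) :
    p = q := by
  rw [← p.mk_rep, ← q.mk_rep, Projectivization.mk_eq_mk_iff']
  rcases rep_zero_ne_zero_or q with h0 | h0
  · refine ⟨p.rep 0 / q.rep 0, ?_⟩
    ext j
    fin_cases j <;> simp <;> field_simp
    linear_combination -h
  · refine ⟨p.rep 1 / q.rep 1, ?_⟩
    ext j
    fin_cases j <;> simp <;> field_simp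
    linear_combination h

theorem pointForm_mem_idealOfPoint {i : Fin 2} {p : Proj1 K} {Z : Pt2 K} :
    pointForm i p ∈ idealOfPoint K 2 (fun _ => 1) Z ↔ Z i = p := by
  simp only [mem_idealOfPoint, eval_pointForm]
  constructor
  · intro h
    refine (eq_of_rep_mul_eq ?_).symm
    simpa [sub_eq_zero] using h fun _ => 1
  · rintro rfl c
    ring

theorem idealOfPoint_eq_span [Infinite K] (Z : Pt2 K) :
    idealOfPoint K 2 (fun _ => 1) Z = Ideal.span {pointForm 0 (Z 0), pointForm 1 (Z 1)} := by
  refine le_antisymm (fun f hf => ?_) ?_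
  · set J := Ideal.span {pointForm 0 (Z 0), pointForm 1 (Z 1)} with hJ
    have hmem (i : Fin 2) : pointForm i (Z i) ∈ J := by
      fin_cases i <;> exact Ideal.subset_span (by simp)
    have hex (i : Fin 2) : ∃ g : R2 K, ∀ j : Fin 2,
        MvPolynomial.X ⟨i, j⟩ - C ((Z i).rep j) * g ∈ J := by
      rcases rep_zero_ne_zero_or (Z i) with h0 | h0
      · refine ⟨C ((Z i).rep 0)⁻¹ * MvPolynomial.X ⟨i, 0⟩, fun j => ?_⟩
        have hC : (C ((Z i).rep 0) : R2 K) * C ((Z i).rep 0)⁻¹ = 1 := by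
          rw [← C_mul, mul_inv_cancel₀ h0, C_1]
        fin_cases j
        · convert J.zero_mem using 1
          simp only [Fin.zero_eta]
          linear_combination (-MvPolynomial.X ⟨i, 0⟩ : R2 K) * hC
        · convert J.mul_mem_left (-C ((Z i).rep 0)⁻¹) (hmem i) using 1
          simp only [Fin.mk_one, pointForm]
          linear_combination (-MvPolynomial.X ⟨i, 1⟩ : R2 K) * hC
      · refine ⟨C ((Z i).rep 1)⁻¹ * MvPolynomial.X ⟨i, 1⟩, fun j => ?_⟩
        have hC : (C ((Z i).rep 1) : R2 K) * C ((Z i).rep 1)⁻¹ = 1 := by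
          rw [← C_mul, mul_inv_cancel₀ h0, C_1]
        fin_cases j
        · convert J.mul_mem_left (C ((Z i).rep 1)⁻¹) (hmem i) using 1
          simp only [Fin.zero_eta, pointForm]
          linear_combination (-MvPolynomial.X ⟨i, 0⟩ : R2 K) * hC
        · convert J.zero_mem using 1
          simp only [Fin.mk_one]
          linear_combination (-MvPolynomial.X ⟨i, 1⟩ : R2 K) * hC
    choose g hg using hex
    have hlift : (Ideal.Quotient.mkₐ K J).comp ((aeval g).comp (conePullback Z)) =
        Ideal.Quotient.mkₐ K J := by
      refine MvPolynomial.algHom_ext fun ⟨i, j⟩ => ?_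
      simp only [AlgHom.comp_apply, conePullback, aeval_X, map_mul, aeval_C, algebraMap_eq,
        Ideal.Quotient.mkₐ_eq_mk]
      rw [← map_mul]
      exact (Ideal.Quotient.eq.2 (hg i j)).symm
    rw [idealOfPoint_eq_ker, RingHom.mem_ker] at hf
    rw [← Ideal.Quotient.eq_zero_iff_mem, ← Ideal.Quotient.mkₐ_eq_mk K, ← hlift]
    simp [hf]
  · rw [Ideal.span_le, Set.insert_subset_iff, Set.singleton_subset_iff]
    exact ⟨pointForm_mem_idealOfPoint.2 rfl, pointForm_mem_idealOfPoint.2 rfl⟩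

theorem pointForm_ne_zero (i : Fin 2) (p : Proj1 K) : pointForm i p ≠ 0 := by
  intro h
  have h0 := eval_pointForm i p (fun s => if s.2 = 0 then 1 else 0)
  have h1 := eval_pointForm i p (fun s => if s.2 = 0 then 0 else 1)
  rw [h] at h0 h1
  rcases rep_zero_ne_zero_or p with hp | hp
  · exact hp (by simpa using h1)
  · exact hp (by simpa using h0.symm)

theorem irreducible_pointForm (i : Fin 2) (p : Proj1 K) : Irreducible (pointForm i p) := by
  refine irreducible_of_totalDegree_eq_one ?_ fun x hx => ?_
  · refine IsHomogeneous.totalDegree (IsHomogeneous.sub ?_ ?_) (pointForm_ne_zero i p) <;>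
      simpa using (isHomogeneous_C _ _).mul (isHomogeneous_X K _)
  · rw [isUnit_iff_ne_zero]
    rintro rfl
    refine pointForm_ne_zero i p ?_
    ext d
    simpa using hx d

theorem not_pointForm_dvd_pointForm {i i' : Fin 2} (hii : i ≠ i') (p q : Proj1 K) :
    ¬ pointForm i p ∣ pointForm i' q := by
  rintro ⟨g, hg⟩
  have key (a b : K) : q.rep 1 * a - q.rep 0 * b = 0 := by
    have h := congrArg (eval fun s : Sig 2 (fun _ => 1) =>
      if s.1 = i then 0 else if s.2 = 0 then a else b) hg
    simpa [eval_pointForm, hii.symm] using h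
  rcases rep_zero_ne_zero_or q with hq | hq
  · exact hq (by simpa using key 0 1)
  · exact hq (by simpa using key 1 0)

/-- A nonzero linear form in the `i`-th set of variables vanishing at `p` is a scalar multiple of
`pointForm i p`. -/
theorem associated_pointForm {i : Fin 2} {p : Proj1 K} {f : R2 K}
    (hf : IsWeightedHomogeneous (wt 2 (fun _ => 1)) f (Pi.single i 1)) (hf0 : f ≠ 0)
    (hfp : ∀ x : Sig 2 (fun _ => 1) → K,
      (∃ c : K, (fun j : Fin 2 => x ⟨i, j⟩) = c • p.rep) → eval x f = 0) :
    Associated f (pointForm i p) := by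
  have hsum := eq_sum_of_isWeightedHomogeneous_single hf
  rw [Fin.sum_univ_two] at hsum
  set a := coeff (Finsupp.single ⟨i, 0⟩ 1) f
  set b := coeff (Finsupp.single ⟨i, 1⟩ 1) f
  have hab : a * p.rep 0 + b * p.rep 1 = 0 := by
    have h := hfp (fun s => p.rep s.2) ⟨1, by simp⟩
    rw [hsum] at h
    simpa using h
  obtain ⟨l, hl⟩ : ∃ l : K, f = C l * pointForm i p := by
    rcases rep_zero_ne_zero_or p with hp | hp
    · have ha : a = -b / p.rep 0 * p.rep 1 := by field_simp; linear_combination hab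
      have hb : b = -(-b / p.rep 0 * p.rep 0) := by field_simp
      refine ⟨-b / p.rep 0, ?_⟩
      rw [hsum, ha]
      nth_rw 2 [hb]
      simp only [pointForm, C_mul, C_neg]
      ring
    · have ha : a = a / p.rep 1 * p.rep 1 := by field_simp
      have hb : b = -(a / p.rep 1 * p.rep 0) := by field_simp; linear_combination hab
      refine ⟨a / p.rep 1, ?_⟩
      rw [hsum, hb]
      nth_rw 1 [ha]
      simp only [pointForm, C_mul, C_neg]
      ring
  have hl0 : l ≠ 0 := by
    rintro rfl
    exact hf0 (by simpa using hl)
  rw [hl]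
  exact associated_unit_mul_left _ _ ((isUnit_iff_ne_zero.2 hl0).map C)

/-- The ideal of the grid of points `P i × Q j`. -/
theorem idealOfSet_grid [Infinite K] {ι κ : Type*} [Fintype ι] [Fintype κ] {P : ι → Proj1 K}
    {Q : κ → Proj1 K} (hP : Function.Injective P) (hQ : Function.Injective Q) :
    idealOfSet K 2 (fun _ => 1)
        {Z : Pt2 K | ∃ i j, Z = fun m : Fin 2 => if m = 0 then P i else Q j} =
      Ideal.span {∏ i, pointForm 0 (P i), ∏ j, pointForm 1 (Q j)} := by
  have hpt (i : ι) (j : κ) : idealOfPoint K 2 (fun _ => 1)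
      (fun m : Fin 2 => if m = 0 then P i else Q j) =
        Ideal.span {pointForm 0 (P i), pointForm 1 (Q j)} := by
    rw [idealOfPoint_eq_span]
    simp
  rw [← iInf_span_pair_eq_span_prod]
  · simp only [← hpt]
    ext f
    simp only [idealOfSet, Ideal.mem_iInf, Set.mem_ofPred_eq]
    exact ⟨fun h i j => h _ ⟨i, j, rfl⟩, fun h Z ⟨i, j, hZ⟩ => hZ ▸ h i j⟩
  · intro i j
    rw [← hpt]
    exact idealOfPoint_isPrime _
  · intro i i' j hne
    rw [← hpt, pointForm_mem_idealOfPoint]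
    simpa using fun h => hne (hP h).symm
  · intro i j j' hne
    rw [← hpt, pointForm_mem_idealOfPoint]
    simpa using fun h => hne (hQ h).symm

/-- A set of points with as many elements as the grid spanned by its projections is that grid. -/
theorem eq_grid_of_ncard_eq {X : Set (Pt2 K)} {t r : ℕ} {P : Fin t → Proj1 K}
    {Q : Fin r → Proj1 K} (hP : Set.range P = (fun Z : Pt2 K => Z 0) '' X)
    (hQ : Set.range Q = (fun Z : Pt2 K => Z 1) '' X) (hcard : X.ncard = t * r) :
    X = {Z : Pt2 K | ∃ i j, Z = fun m : Fin 2 => if m = 0 then P i else Q j} := by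
  have hgrid : {Z : Pt2 K | ∃ i j, Z = fun m : Fin 2 => if m = 0 then P i else Q j} =
      Set.range fun ij : Fin t × Fin r => fun m : Fin 2 => if m = 0 then P ij.1 else Q ij.2 := by
    ext Z
    simp [eq_comm]
  have hfin := Set.finite_range
    fun ij : Fin t × Fin r => fun m : Fin 2 => if m = 0 then P ij.1 else Q ij.2
  rw [hgrid]
  refine Set.eq_of_subset_of_ncard_le (fun Z hZ => ?_) ?_ hfin
  · obtain ⟨i, hi⟩ : Z 0 ∈ Set.range P := hP ▸ ⟨Z, hZ, rfl⟩
    obtain ⟨j, hj⟩ : Z 1 ∈ Set.range Q := hQ ▸ ⟨Z, hZ, rfl⟩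
    refine ⟨(i, j), ?_⟩
    ext m : 1
    fin_cases m
    exacts [hi, hj]
  · rw [hcard, ← Set.image_univ]
    refine (Set.ncard_image_le Set.finite_univ).trans ?_
    simp [Set.ncard_univ]

end ProjectiveLines

/-- if `α_X = (r,…,r)` (`t` times) and `β_X = (t,…,t)` (`r` times), then
`X` is the full `t × r` grid, `I_X = (L_{P_1}⋯L_{P_t}, L_{Q_1}⋯L_{Q_r})`, the two
generators (of degrees `(t,0)` and `(0,r)`) form a regular sequence on `R`, and the
minimal free resolution of `I_X` is the Koszul resolution
`0 → R(-t,-r) → R(-t,0) ⊕ R(0,-r) → I_X → 0`. -/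
theorem statement_14 (K : Type) [Field K] [IsAlgClosed K] [CharZero K]
    (X : Set (Pt2 K)) (hX : X.Finite) (t r : ℕ)
    (P : Fin t → Proj1 K) (Q : Fin r → Proj1 K)
    (hα : IsAlphaLabel K X P (fun _ => r)) (hβ : IsBetaLabel K X Q (fun _ => t))
    (hcard : X.ncard = t * r)
    (LP : Fin t → R2 K) (LQ : Fin r → R2 K)
    (hLP : ∀ i, IsForm1Of K (P i) (LP i)) (hLQ : ∀ j, IsForm2Of K (Q j) (LQ j))
    (F G : R2 K) (hF : F = ∏ i, LP i) (hG : G = ∏ j, LQ j) :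
    (X = {Z : Pt2 K | ∃ (i : Fin t) (j : Fin r),
        Z = fun m : Fin 2 => if m = 0 then P i else Q j}) ∧
    MvPolynomial.IsWeightedHomogeneous (wt 2 (fun _ => 1)) F ![t, 0] ∧
    MvPolynomial.IsWeightedHomogeneous (wt 2 (fun _ => 1)) G ![0, r] ∧
    idealOfSet K 2 (fun _ => 1) X = Ideal.span {F, G} ∧
    (∀ a : R2 K, F * a = 0 → a = 0) ∧
    (∀ a : R2 K, G * a ∈ Ideal.span {F} → a ∈ Ideal.span {F}) ∧
    (∀ a b : R2 K, a * F + b * G = 0 → ∃ c : R2 K, a = c * G ∧ b = -(c * F)) := by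
  have hLP' (i : Fin t) : Associated (LP i) (pointForm 0 (P i)) :=
    associated_pointForm (hLP i).1 (hLP i).2.1 (hLP i).2.2
  have hLQ' (j : Fin r) : Associated (LQ j) (pointForm 1 (Q j)) :=
    associated_pointForm (hLQ j).1 (hLQ j).2.1 (hLQ j).2.2
  have hF0 : F ≠ 0 := hF ▸ Finset.prod_ne_zero_iff.2 fun i _ => (hLP i).2.1
  have hG0 : G ≠ 0 := hG ▸ Finset.prod_ne_zero_iff.2 fun j _ => (hLQ j).2.1
  have hrel : IsRelPrime F G := by
    rw [hF, hG]
    refine IsRelPrime.prod_left fun i _ => IsRelPrime.prod_right fun j _ => ?_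
    rw [((hLP' i).irreducible_iff.2 (irreducible_pointForm _ _)).isRelPrime_iff_not_dvd,
      (hLP' i).dvd_iff_dvd_left, (hLQ' j).dvd_iff_dvd_right]
    exact not_pointForm_dvd_pointForm zero_ne_one _ _
  have hgrid := eq_grid_of_ncard_eq hα.2.1 hβ.2.1 hcard
  refine ⟨hgrid, ?_, ?_, ?_, ?_, ?_, ?_⟩
  · convert IsWeightedHomogeneous.prod Finset.univ LP (fun _ => Pi.single 0 1)
      fun i _ => (hLP i).1 using 1
    ext m
    fin_cases m <;> simp
  · convert IsWeightedHomogeneous.prod Finset.univ LQ (fun _ => Pi.single 1 1)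
      fun j _ => (hLQ j).1 using 1
    ext m
    fin_cases m <;> simp
  · rw [hgrid, idealOfSet_grid hα.1 hβ.1, Ideal.span_insert, Ideal.span_insert, hF, hG]
    congr 1
    · exact (Ideal.span_singleton_eq_span_singleton.2
        (Associated.prod _ _ _ fun i _ => hLP' i)).symm
    · exact (Ideal.span_singleton_eq_span_singleton.2
        (Associated.prod _ _ _ fun j _ => hLQ' j)).symm
  · exact fun a ha => (mul_eq_zero.1 ha).resolve_left hF0
  · intro a ha
    rw [Ideal.mem_span_singleton] at ha ⊢
    exact hrel.dvd_of_dvd_mul_left ha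
  · intro a b hab
    obtain ⟨c, rfl⟩ : G ∣ a := by
      refine hrel.symm.dvd_of_dvd_mul_right ⟨-b, ?_⟩
      linear_combination hab
    refine ⟨c, mul_comm _ _, mul_left_cancel₀ hG0 ?_⟩
    linear_combination hab

end PaperMP
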